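/- The matrix coefficients a_ij (defined by Δ(t_i) = Σ_j a_ij ⊗ t_j for a basis {t_i} of T^ε) vanish on all but finitely many elements of P₊ and of P₋, where P₊ (resp. P₋) is the set of monomials in the generators z_kl with k < l (resp. k > l). In particular the generators z_kl with k ≠ l act as nilpotent operators on the finite-dimensional representation of B determined by the a_ij. -/

import Mathlib

noncomputable section

open scoped TensorProduct

/-- Cartan integers of `sl_N`. -/
def cartanSL (i j : ℕ) : ℤ :=
  if i = j then 2 else if ((i : ℤ) - j).natAbs = 1 then -1 else 0

/-- The defining relations of `U_q(sl_N)` for a candidate family of generators. -/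
def UqslRels (q : ℝ) (N : ℕ) {V : Type} [Ring V] [Algebra ℂ V]
    (e f kg ki : ℕ → V) : Prop :=
  (∀ i ∈ Finset.Icc 1 (N - 1), kg i * ki i = 1 ∧ ki i * kg i = 1) ∧
  (∀ i ∈ Finset.Icc 1 (N - 1), ∀ j ∈ Finset.Icc 1 (N - 1),
      kg i * kg j = kg j * kg i) ∧
  (∀ i ∈ Finset.Icc 1 (N - 1), ∀ j ∈ Finset.Icc 1 (N - 1),
      kg i * e j = ((q : ℂ) ^ (cartanSL i j)) • (e j * kg i)) ∧
  (∀ i ∈ Finset.Icc 1 (N - 1), ∀ j ∈ Finset.Icc 1 (N - 1),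
      kg i * f j = ((q : ℂ) ^ (-cartanSL i j)) • (f j * kg i)) ∧
  (∀ i ∈ Finset.Icc 1 (N - 1), ∀ j ∈ Finset.Icc 1 (N - 1),
      e i * f j - f j * e i =
        if i = j then (((q : ℂ) - (q : ℂ)⁻¹)⁻¹) • (kg i - ki i) else 0) ∧
  (∀ i ∈ Finset.Icc 1 (N - 1), ∀ j ∈ Finset.Icc 1 (N - 1), ((i : ℤ) - j).natAbs = 1 →
      e i * e i * e j - ((q : ℂ) + (q : ℂ)⁻¹) • (e i * e j * e i) + e j * e i * e i = 0) ∧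
  (∀ i ∈ Finset.Icc 1 (N - 1), ∀ j ∈ Finset.Icc 1 (N - 1), 2 ≤ ((i : ℤ) - j).natAbs →
      e i * e j = e j * e i) ∧
  (∀ i ∈ Finset.Icc 1 (N - 1), ∀ j ∈ Finset.Icc 1 (N - 1), ((i : ℤ) - j).natAbs = 1 →
      f i * f i * f j - ((q : ℂ) + (q : ℂ)⁻¹) • (f i * f j * f i) + f j * f i * f i = 0) ∧
  (∀ i ∈ Finset.Icc 1 (N - 1), ∀ j ∈ Finset.Icc 1 (N - 1), 2 ≤ ((i : ℤ) - j).natAbs →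
      f i * f j = f j * f i)

/-- The quantized enveloping algebra `U_q(sl_N)` together with its Hopf algebra
structure, generators, defining relations and universal property. -/
structure UqslData (q : ℝ) (N : ℕ) where
  U : Type
  [instRing : Ring U]
  [instHopf : HopfAlgebra ℂ U]
  E : ℕ → U
  F : ℕ → U
  Kg : ℕ → U
  Ki : ℕ → U
  rels : UqslRels q N E F Kg Ki
  comul_E : ∀ i ∈ Finset.Icc 1 (N - 1),
    Coalgebra.comul (R := ℂ) (E i) = E i ⊗ₜ[ℂ] 1 + Kg i ⊗ₜ[ℂ] E i
  comul_F : ∀ i ∈ Finset.Icc 1 (N - 1),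
    Coalgebra.comul (R := ℂ) (F i) = F i ⊗ₜ[ℂ] Ki i + 1 ⊗ₜ[ℂ] F i
  comul_Kg : ∀ i ∈ Finset.Icc 1 (N - 1),
    Coalgebra.comul (R := ℂ) (Kg i) = Kg i ⊗ₜ[ℂ] Kg i
  comul_Ki : ∀ i ∈ Finset.Icc 1 (N - 1),
    Coalgebra.comul (R := ℂ) (Ki i) = Ki i ⊗ₜ[ℂ] Ki i
  counit_E : ∀ i ∈ Finset.Icc 1 (N - 1), Coalgebra.counit (R := ℂ) (E i) = 0
  counit_F : ∀ i ∈ Finset.Icc 1 (N - 1), Coalgebra.counit (R := ℂ) (F i) = 0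
  counit_Kg : ∀ i ∈ Finset.Icc 1 (N - 1), Coalgebra.counit (R := ℂ) (Kg i) = 1
  counit_Ki : ∀ i ∈ Finset.Icc 1 (N - 1), Coalgebra.counit (R := ℂ) (Ki i) = 1
  gen : Algebra.adjoin ℂ
      {x : U | ∃ i ∈ Finset.Icc 1 (N - 1), x = E i ∨ x = F i ∨ x = Kg i ∨ x = Ki i} = ⊤
  univ : ∀ (V : Type) [Ring V] [Algebra ℂ V] (e f kg ki : ℕ → V),
      UqslRels q N e f kg ki → ∃ φ : U →ₐ[ℂ] V,
        ∀ i ∈ Finset.Icc 1 (N - 1),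
          φ (E i) = e i ∧ φ (F i) = f i ∧ φ (Kg i) = kg i ∧ φ (Ki i) = ki i

attribute [instance] UqslData.instRing UqslData.instHopf

namespace UqslData

variable {q : ℝ} {N : ℕ} (D : UqslData q N)

/-- Root vectors `E_{α_{i,i+d}}` (iterated `q`-commutators with respect to the
standard reduced decomposition of the longest Weyl group element). -/
def Ev : ℕ → ℕ → D.U
  | 0, i => D.E i
  | d + 1, i => D.E i * Ev d (i + 1) - (q : ℂ)⁻¹ • (Ev d (i + 1) * D.E i)

/-- Root vectors `F_{α_{i,i+d}}`. -/
def Fv : ℕ → ℕ → D.U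
  | 0, i => D.F i
  | d + 1, i => Fv d (i + 1) * D.F i - (q : ℂ)⁻¹ • (D.F i * Fv d (i + 1))

/-- The Hopf subalgebra `K` generated by `E_i, F_i (i ≠ r)` and all `K_j^{±1}`. -/
def Ksub (r : ℕ) : Subalgebra ℂ D.U :=
  Algebra.adjoin ℂ
    ({x : D.U | ∃ i ∈ Finset.Icc 1 (N - 1), i ≠ r ∧ (x = D.E i ∨ x = D.F i)} ∪
     {x : D.U | ∃ j ∈ Finset.Icc 1 (N - 1), x = D.Kg j ∨ x = D.Ki j})

/-- The subspace `K⁺U ⊆ U`. -/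
def Jsub (r : ℕ) : Submodule ℂ D.U :=
  Submodule.span ℂ
    {x : D.U | ∃ k ∈ D.Ksub r, Coalgebra.counit (R := ℂ) k = 0 ∧ ∃ u : D.U, x = k * u}

/-- The subspace `K⁺U ⊗ U + U ⊗ K⁺U` of `U ⊗ U`, i.e. the kernel of `π ⊗ π` where
`π : U → U/K⁺U` is the canonical projection. -/
def JUU (r : ℕ) : Submodule ℂ (D.U ⊗[ℂ] D.U) :=
  LinearMap.range (TensorProduct.map (D.Jsub r).subtype LinearMap.id) ⊔
  LinearMap.range (TensorProduct.map LinearMap.id (D.Jsub r).subtype)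

/-- `x ∈ U` represents a primitive element of the quotient coalgebra `Ū = U/K⁺U`. -/
def IsPrimitiveMod (r : ℕ) (x : D.U) : Prop :=
  Coalgebra.comul (R := ℂ) x - x ⊗ₜ[ℂ] 1 - 1 ⊗ₜ[ℂ] x ∈ D.JUU r

end UqslData

/-- Membership of the pair `(i,j)` in (the index set of) `Φ⁺_r`, the set of positive
roots `α_{ij} = α_i + ⋯ + α_j` of `sl_N` with `i ≤ r ≤ j`. -/
def inPhiR (N r : ℕ) (p : ℕ × ℕ) : Prop :=
  1 ≤ p.1 ∧ p.1 ≤ r ∧ r ≤ p.2 ∧ p.2 ≤ N - 1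



/-- The quantized function algebra `A = O_q(SL_N)` together with the nondegenerate Hopf
pairing with `U = U_q(sl_N)`:  `A` is a Hopf algebra generated by the matrix coefficients
`u^i_j` of the fundamental corepresentation, and the pairing is fixed by its values on
the generators (the fundamental representation of `U_q(sl_N)`). -/
structure QslnFun (q : ℝ) (N : ℕ) (D : UqslData q N) where
  A : Type
  [instRingA : Ring A]
  [instHopfA : HopfAlgebra ℂ A]
  u : ℕ → ℕ → A
  genA : Algebra.adjoin ℂ
      {x : A | ∃ i ∈ Finset.Icc 1 N, ∃ j ∈ Finset.Icc 1 N, x = u i j} = ⊤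
  comul_u : ∀ i ∈ Finset.Icc 1 N, ∀ j ∈ Finset.Icc 1 N,
    Coalgebra.comul (R := ℂ) (u i j) = ∑ k ∈ Finset.Icc 1 N, u i k ⊗ₜ[ℂ] u k j
  counit_u : ∀ i ∈ Finset.Icc 1 N, ∀ j ∈ Finset.Icc 1 N,
    Coalgebra.counit (R := ℂ) (u i j) = if i = j then 1 else 0
  pair : D.U →ₗ[ℂ] A →ₗ[ℂ] ℂ
  pair_mulU : ∀ (x y : D.U) (a : A), pair (x * y) a =
    LinearMap.mul' ℂ ℂ (TensorProduct.map (pair x) (pair y) (Coalgebra.comul (R := ℂ) a))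
  pair_mulA : ∀ (x : D.U) (a b : A), pair x (a * b) =
    LinearMap.mul' ℂ ℂ (TensorProduct.map (pair.flip a) (pair.flip b)
      (Coalgebra.comul (R := ℂ) x))
  pair_oneU : ∀ a : A, pair 1 a = Coalgebra.counit (R := ℂ) a
  pair_oneA : ∀ x : D.U, pair x 1 = Coalgebra.counit (R := ℂ) x
  pair_antipode : ∀ (x : D.U) (a : A),
    pair (HopfAlgebra.antipode (R := ℂ) x) a = pair x (HopfAlgebra.antipode (R := ℂ) a)
  pair_E : ∀ l ∈ Finset.Icc 1 (N - 1), ∀ i ∈ Finset.Icc 1 N, ∀ j ∈ Finset.Icc 1 N,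
    pair (D.E l) (u i j) = if i = l ∧ j = l + 1 then 1 else 0
  pair_F : ∀ l ∈ Finset.Icc 1 (N - 1), ∀ i ∈ Finset.Icc 1 N, ∀ j ∈ Finset.Icc 1 N,
    pair (D.F l) (u i j) = if i = l + 1 ∧ j = l then 1 else 0
  pair_Kg : ∀ l ∈ Finset.Icc 1 (N - 1), ∀ i ∈ Finset.Icc 1 N, ∀ j ∈ Finset.Icc 1 N,
    pair (D.Kg l) (u i j) =
      if i = j then (if i = l then (q : ℂ) else if i = l + 1 then (q : ℂ)⁻¹ else 1) else 0
  pair_Ki : ∀ l ∈ Finset.Icc 1 (N - 1), ∀ i ∈ Finset.Icc 1 N, ∀ j ∈ Finset.Icc 1 N,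
    pair (D.Ki l) (u i j) =
      if i = j then (if i = l then (q : ℂ)⁻¹ else if i = l + 1 then (q : ℂ) else 1) else 0
  nondegU : ∀ x : D.U, (∀ a : A, pair x a = 0) → x = 0
  nondegA : ∀ a : A, (∀ x : D.U, pair x a = 0) → a = 0

attribute [instance] QslnFun.instRingA QslnFun.instHopfA

namespace QslnFun

variable {q : ℝ} {N : ℕ} {D : UqslData q N} (P : QslnFun q N D)

/-- For `k : U`, the operator `a ↦ ⟨k, a₍₁₎⟩ a₍₂₎` on `A`. -/
def hitL (k : D.U) : P.A →ₗ[ℂ] P.A :=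
  TensorProduct.lift ((LinearMap.lsmul ℂ P.A).comp (P.pair k)) ∘ₗ
    Coalgebra.comul (R := ℂ)

/-- The quantum Grassmannian `B = O_q(Gr(r,N))` inside `A`, as the subspace
`{b ∈ A | ⟨k, b₍₁₎⟩ b₍₂₎ = 0 for all k ∈ K⁺}`. -/
def Bmod (r : ℕ) : Submodule ℂ P.A :=
  ⨅ k : ↥(D.Ksub r),
    LinearMap.ker (P.hitL ((k : D.U) - algebraMap ℂ D.U
      (Coalgebra.counit (R := ℂ) (k : D.U))))

end QslnFun



section DualDefs

variable {U A : Type} [Ring U] [HopfAlgebra ℂ U] [Ring A] [HopfAlgebra ℂ A]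

/-- The subspace `A·B⁺ ⊆ A`. -/
def ABp (Bsub : Subalgebra ℂ A) : Submodule ℂ A :=
  Submodule.span ℂ
    {x : A | ∃ a : A, ∃ b ∈ Bsub, Coalgebra.counit (R := ℂ) b = 0 ∧ x = a * b}

/-- The map `Δ̄ : B → A ⊗ Ā`, where `Ā = A/AB⁺`. -/
def DbarB (Bsub : Subalgebra ℂ A) :
    ↥Bsub →ₗ[ℂ] A ⊗[ℂ] (A ⧸ ABp Bsub) :=
  (TensorProduct.map LinearMap.id (ABp Bsub).mkQ) ∘ₗ (Coalgebra.comul (R := ℂ)) ∘ₗ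
    Bsub.val.toLinearMap

/-- The counit of `A` restricted to the subalgebra `B`. -/
def counitB (Bsub : Subalgebra ℂ A) : Module.Dual ℂ ↥Bsub :=
  (Coalgebra.counit (R := ℂ) (A := A)) ∘ₗ Bsub.val.toLinearMap

/-- The augmentation ideal `B⁺ = B ∩ ker ε` of `B`. -/
def BplusB (Bsub : Subalgebra ℂ A) : Submodule ℂ ↥Bsub :=
  LinearMap.ker (counitB Bsub)

/-- `Δ̄(I) ⊆ I ⊗ Ā`. -/
def DbarStable (Bsub : Subalgebra ℂ A) (I : Submodule ℂ ↥Bsub) : Prop :=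
  ∀ x ∈ I, DbarB Bsub x ∈
    LinearMap.range (TensorProduct.map (Bsub.val.toLinearMap ∘ₗ I.subtype)
      (LinearMap.id (R := ℂ) (M := A ⧸ ABp Bsub)))

/-- The data of a covariant first order differential calculus over `B`, in the form of
the associated left ideal: `I ⊆ B⁺`, `B·I ⊆ I` and `Δ̄(I) ⊆ I ⊗ Ā`. -/
def FODCIdeal (Bsub : Subalgebra ℂ A) (I : Submodule ℂ ↥Bsub) : Prop :=
  I ≤ BplusB Bsub ∧ (∀ b : ↥Bsub, ∀ x ∈ I, b * x ∈ I) ∧ DbarStable Bsub I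

/-- The quantum tangent space `T(Γ) = {f ∈ B' | f(1) = 0, f(I) = 0}` of the covariant
calculus corresponding to the ideal `I`. -/
def TanOfIdeal (Bsub : Subalgebra ℂ A) (I : Submodule ℂ ↥Bsub) :
    Submodule ℂ (Module.Dual ℂ ↥Bsub) :=
  (⨅ x : ↥I, LinearMap.ker (Module.Dual.eval ℂ ↥Bsub ((x : ↥I) : ↥Bsub))) ⊓
    LinearMap.ker (Module.Dual.eval ℂ ↥Bsub (1 : ↥Bsub))

/-- `g` is the result of the right action of `k ∈ U` on the functional `f ∈ B'`:
`g(b) = f(b₍₀₎) ⟨k, b₍₁₎⟩` where `Δ(b) = b₍₀₎ ⊗ b₍₁₎ ∈ B ⊗ A`. -/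
def IsDualAct (pair : U →ₗ[ℂ] A →ₗ[ℂ] ℂ) (Bsub : Subalgebra ℂ A)
    (f : Module.Dual ℂ ↥Bsub) (k : U) (g : Module.Dual ℂ ↥Bsub) : Prop :=
  ∀ (b : ↥Bsub) (c : ↥Bsub ⊗[ℂ] A),
    TensorProduct.map Bsub.val.toLinearMap LinearMap.id c =
      Coalgebra.comul (R := ℂ) (b : A) →
    g b = TensorProduct.lift (((LinearMap.mul ℂ ℂ) ∘ₗ f).compl₂ (pair k)) c

end DualDefs

/-- The generators `z_{ij}` of the quantum Grassmannian `B ⊆ A`, given by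
`z_{ij} = Σ_{k=r+1}^{N} q^{-2N-1+2k} u^k_i S(u^j_k)`. -/
noncomputable def zGen {q : ℝ} {N : ℕ} {D : UqslData q N} (P : QslnFun q N D)
    (r i j : ℕ) : P.A :=
  ∑ k ∈ Finset.Icc (r + 1) N,
    ((q : ℂ) ^ (2 * (k : ℤ) - (2 * (N : ℤ) + 1))) •
      (P.u k i * HopfAlgebra.antipode (R := ℂ) (P.u j k))

section RightTranslation

variable {A : Type} [Ring A] [HopfAlgebra ℂ A]

/-- For a functional `φ` on `A`, the operator `a ↦ φ(a₍₂₎) a₍₁₎`. -/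
def rightHit (φ : A →ₗ[ℂ] ℂ) : A →ₗ[ℂ] A :=
  (TensorProduct.rid ℂ A).toLinearMap ∘ₗ φ.lTensor A ∘ₗ Coalgebra.comul (R := ℂ)

/-- For a character `χ` of `A`, the algebra endomorphism `a ↦ χ(a₍₂₎) a₍₁₎`. -/
def rightTranslation (χ : A →ₐ[ℂ] ℂ) : A →ₐ[ℂ] A :=
  ((Algebra.TensorProduct.rid ℂ ℂ A).toAlgHom.comp
    (Algebra.TensorProduct.map (AlgHom.id ℂ A) χ)).comp (Bialgebra.comulAlgHom ℂ A)

theorem rightTranslation_apply (χ : A →ₐ[ℂ] ℂ) (a : A) :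
    rightTranslation χ a = rightHit χ.toLinearMap a := rfl

theorem comul_rightHit (φ : A →ₗ[ℂ] ℂ) (a : A) :
    Coalgebra.comul (R := ℂ) (rightHit φ a) =
      (rightHit φ).lTensor A (Coalgebra.comul (R := ℂ) a) := by
  have key : ∀ y : A ⊗[ℂ] (A ⊗[ℂ] A),
      TensorProduct.rid ℂ (A ⊗[ℂ] A) (φ.lTensor (A ⊗[ℂ] A)
        ((TensorProduct.assoc ℂ A A A).symm y)) =
      ((TensorProduct.rid ℂ A).toLinearMap ∘ₗ φ.lTensor A).lTensor A y := by
    intro y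
    induction y with
    | zero => simp
    | add x y hx hy => simp only [map_add, hx, hy]
    | tmul x y =>
      induction y with
      | zero => simp
      | add y z hy hz => simp only [TensorProduct.tmul_add, map_add, hy, hz]
      | tmul y z => simp
  have push : ∀ y : A ⊗[ℂ] A,
      Coalgebra.comul (R := ℂ) (TensorProduct.rid ℂ A (φ.lTensor A y)) =
      TensorProduct.rid ℂ (A ⊗[ℂ] A) (φ.lTensor (A ⊗[ℂ] A)
        ((Coalgebra.comul (R := ℂ)).rTensor A y)) := by
    intro y
    induction y with
    | zero => simp
    | add x y hx hy => simp only [map_add, hx, hy]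
    | tmul x y => simp
  have h : rightHit φ a = TensorProduct.rid ℂ A (φ.lTensor A (Coalgebra.comul (R := ℂ) a)) := rfl
  rw [h, push, ← Coalgebra.coassoc_symm_apply, key, ← LinearMap.lTensor_comp_apply]
  rfl

theorem counit_rightHit (φ : A →ₗ[ℂ] ℂ) (a : A) :
    Coalgebra.counit (R := ℂ) (rightHit φ a) = φ a := by
  have h : ∀ y : A ⊗[ℂ] A,
      Coalgebra.counit (R := ℂ) (TensorProduct.rid ℂ A (φ.lTensor A y)) =
      φ (TensorProduct.lid ℂ A ((Coalgebra.counit (R := ℂ)).rTensor A y)) := by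
    intro y
    induction y with
    | zero => simp
    | add x y hx hy => simp only [map_add, hx, hy]
    | tmul x y => simp [mul_comm]
  refine (h _).trans ?_
  simp

theorem rightHit_rightHit (φ ψ : A →ₗ[ℂ] ℂ) (a : A) :
    rightHit φ (rightHit ψ a) = rightHit (φ ∘ₗ rightHit ψ) a := by
  change TensorProduct.rid ℂ A (φ.lTensor A (Coalgebra.comul (R := ℂ) (rightHit ψ a))) = _
  rw [comul_rightHit, ← LinearMap.lTensor_comp_apply]
  rfl

theorem rightHit_counit (a : A) : rightHit (Coalgebra.counit (R := ℂ)) a = a := by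
  simp [rightHit]

theorem map_rightHit (φ ψ : A →ₗ[ℂ] ℂ) (a : A) :
    φ (rightHit ψ a) =
      LinearMap.mul' ℂ ℂ (TensorProduct.map φ ψ (Coalgebra.comul (R := ℂ) a)) := by
  have h : ∀ y : A ⊗[ℂ] A, φ (TensorProduct.rid ℂ A (ψ.lTensor A y)) =
      LinearMap.mul' ℂ ℂ (TensorProduct.map φ ψ y) := by
    intro y
    induction y with
    | zero => simp
    | add x y hx hy => simp only [map_add, hx, hy]
    | tmul x y => simp [mul_comm]
  exact h _

theorem rightHit_mem_of_DbarStable {Bsub : Subalgebra ℂ A} {I : Submodule ℂ ↥Bsub}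
    (hI : DbarStable Bsub I) {φ : A →ₗ[ℂ] ℂ} (hφ : ∀ x ∈ ABp Bsub, φ x = 0)
    {x : ↥Bsub} (hx : x ∈ I) : ∃ y ∈ I, (y : A) = rightHit φ x := by
  let φbar : A ⧸ ABp Bsub →ₗ[ℂ] ℂ := (ABp Bsub).liftQ φ fun x hx => hφ x hx
  let ev : A ⊗[ℂ] (A ⧸ ABp Bsub) →ₗ[ℂ] A :=
    (TensorProduct.rid ℂ A).toLinearMap ∘ₗ φbar.lTensor A
  have hev : ∀ y : A ⊗[ℂ] A, ev (TensorProduct.map LinearMap.id (ABp Bsub).mkQ y) =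
      TensorProduct.rid ℂ A (φ.lTensor A y) := by
    intro y
    induction y with
    | zero => simp
    | add x y hx hy => simp only [map_add, hx, hy]
    | tmul x y =>
      simp only [TensorProduct.map_tmul, LinearMap.id_apply, ev, φbar, LinearMap.comp_apply,
        LinearMap.lTensor_tmul, Submodule.mkQ_apply, LinearEquiv.coe_coe]
      exact congrArg (fun c => TensorProduct.rid ℂ A (x ⊗ₜ[ℂ] c)) (Submodule.liftQ_apply _ _ _)
  obtain ⟨c, hc⟩ := hI x hx
  have hrange : ∀ c : ↥I ⊗[ℂ] (A ⧸ ABp Bsub), ∃ y ∈ I,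
      (y : A) = ev (TensorProduct.map (Bsub.val.toLinearMap ∘ₗ I.subtype) LinearMap.id c) := by
    intro c
    induction c with
    | zero => exact ⟨0, I.zero_mem, by simp⟩
    | add c d hc hd =>
      obtain ⟨y, hy, hy'⟩ := hc
      obtain ⟨z, hz, hz'⟩ := hd
      exact ⟨y + z, I.add_mem hy hz, by simp only [map_add, ← hy', ← hz', Subalgebra.coe_add]⟩
    | tmul y d => exact ⟨φbar d • (y : ↥Bsub), I.smul_mem _ y.2, by simp [ev]⟩
  obtain ⟨y, hy, hy'⟩ := hrange c
  refine ⟨y, hy, ?_⟩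
  rw [hy', hc]
  exact hev _

end RightTranslation

section Covariance

variable {B : Type} [Ring B] [Algebra ℂ B] {n : ℕ}
  {t : Fin n → Module.Dual ℂ B} {a : Fin n → Fin n → Module.Dual ℂ B}

/-- A vector of scalars is determined by its combination of linearly independent functionals. -/
theorem matrix_eq_of_sum_dual_eq (ht : LinearIndependent ℂ t) {X Y : Matrix (Fin n) (Fin n) ℂ}
    (h : ∀ i c, ∑ j, X i j * t j c = ∑ j, Y i j * t j c) : X = Y := by
  ext i j
  have h0 : ∑ j, (X i j - Y i j) • t j = 0 := by
    ext c
    simpa [sub_mul, sub_eq_zero] using h i c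
  exact sub_eq_zero.1 (Fintype.linearIndependent_iff.1 ht _ h0 j)

theorem coefficient_matrix_mul (ht : LinearIndependent ℂ t)
    (ha : ∀ (i : Fin n) (b c : B), t i (b * c) = ∑ j, a i j b * t j c) (b c : B) :
    (Matrix.of fun i j => a i j (b * c)) =
      (Matrix.of fun i j => a i j b) * Matrix.of fun i j => a i j c := by
  refine matrix_eq_of_sum_dual_eq ht fun i d => ?_
  simp only [Matrix.mul_apply, Matrix.of_apply, Finset.sum_mul]
  rw [← ha, mul_assoc, ha, Finset.sum_comm]
  simp only [ha _ c d, Finset.mul_sum, mul_assoc]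

theorem coefficient_matrix_one (ht : LinearIndependent ℂ t)
    (ha : ∀ (i : Fin n) (b c : B), t i (b * c) = ∑ j, a i j b * t j c) :
    (Matrix.of fun i j => a i j 1) = (1 : Matrix (Fin n) (Fin n) ℂ) := by
  refine matrix_eq_of_sum_dual_eq ht fun i d => ?_
  simp only [Matrix.of_apply, Matrix.one_apply, ite_mul, one_mul, zero_mul]
  rw [← ha]
  simp

theorem coefficient_matrix_pow (ht : LinearIndependent ℂ t)
    (ha : ∀ (i : Fin n) (b c : B), t i (b * c) = ∑ j, a i j b * t j c) (b : B) (m : ℕ) :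
    (Matrix.of fun i j => a i j (b ^ m)) = (Matrix.of fun i j => a i j b) ^ m := by
  induction m with
  | zero => simpa using coefficient_matrix_one ht ha
  | succ m ih => rw [pow_succ, pow_succ, coefficient_matrix_mul ht ha, ih]

/-- If an automorphism `R` of `B` preserves the span of the functionals `t i`, then the
matrix coefficients are nonzero on eigenvectors of `R` for finitely many eigenvalues only. -/
theorem finite_eigenvalues_coefficients_ne_zero (ht : LinearIndependent ℂ t)
    (ha : ∀ (i : Fin n) (b c : B), t i (b * c) = ∑ j, a i j b * t j c)
    (R : B →ₐ[ℂ] B) (R' : B →ₗ[ℂ] B) (hRR : ∀ b, R (R' b) = b)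
    (hR : ∀ i, t i ∘ₗ R.toLinearMap ∈ Submodule.span ℂ (Set.range t))
    (hR' : ∀ i, t i ∘ₗ R' ∈ Submodule.span ℂ (Set.range t)) :
    {μ : ℂ | ∃ b, R b = μ • b ∧ ∃ i j, a i j b ≠ 0}.Finite := by
  simp only [Submodule.mem_span_range_iff_exists_fun] at hR hR'
  choose M hM using hR
  choose M' hM' using hR'
  replace hM : ∀ i b, t i (R b) = ∑ j, M i j * t j b := fun i b => by
    simpa using (LinearMap.congr_fun (hM i) b).symm
  replace hM' : ∀ i b, t i (R' b) = ∑ j, M' i j * t j b := fun i b => by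
    simpa using (LinearMap.congr_fun (hM' i) b).symm
  have hMM : Matrix.of M * Matrix.of M' = 1 := by
    refine matrix_eq_of_sum_dual_eq ht fun i b => ?_
    have h := hM i (R' b)
    rw [hRR] at h
    simp only [hM', Finset.mul_sum, ← mul_assoc] at h
    simp only [Matrix.mul_apply, Matrix.of_apply, Finset.sum_mul, Matrix.one_apply, ite_mul,
      one_mul, zero_mul, Finset.sum_ite_eq, Finset.mem_univ, if_true]
    rw [Finset.sum_comm, ← h]
  have hcov : ∀ b, (Matrix.of fun i j => a i j (R b)) * Matrix.of M =
      Matrix.of M * Matrix.of fun i j => a i j b := by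
    intro b
    refine matrix_eq_of_sum_dual_eq ht fun i c => ?_
    have h := hM i (b * c)
    simp only [map_mul, ha, hM, Finset.mul_sum, ← mul_assoc] at h
    simp only [Matrix.mul_apply, Matrix.of_apply, Finset.sum_mul]
    rw [Finset.sum_comm, h, Finset.sum_comm]
  let ad : Module.End ℂ (Matrix (Fin n) (Fin n) ℂ) :=
    LinearMap.mulLeft ℂ (Matrix.of M) ∘ₗ LinearMap.mulRight ℂ (Matrix.of M')
  refine (Module.End.finite_hasEigenvalue ad).subset ?_
  rintro μ ⟨b, hb, i, j, hij⟩
  refine Module.End.hasEigenvalue_of_hasEigenvector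
    (x := Matrix.of fun i j => a i j b) ⟨?_, fun h0 => hij ?_⟩
  · rw [Module.End.mem_eigenspace_iff]
    have h : ad (Matrix.of fun i j => a i j b) =
        (Matrix.of M * Matrix.of fun i j => a i j b) * Matrix.of M' := by
      simp [ad, Matrix.mul_assoc]
    rw [h, ← hcov, Matrix.mul_assoc, hMM, mul_one, hb]
    ext i j
    simp
  · exact congrFun (congrFun h0 i) j

end Covariance

theorem zpow_injective_of_transcendental {q : ℝ} (hq : Transcendental ℚ q) :
    Function.Injective fun m : ℤ => (q : ℂ) ^ m := by
  have h0 : q ≠ 0 := by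
    rintro rfl
    exact hq isAlgebraic_zero
  have h1 : |q| ≠ 1 := by
    intro h
    rcases eq_or_eq_neg_of_abs_eq h with rfl | rfl
    · exact hq isAlgebraic_one
    · exact hq isAlgebraic_one.neg
  intro m m' h
  have h' : ‖(q : ℂ) ^ m‖ = ‖(q : ℂ) ^ m'‖ := congrArg norm h
  rw [norm_zpow, norm_zpow, Complex.norm_real, Real.norm_eq_abs] at h'
  exact zpow_right_injective₀ (abs_pos.2 h0) h1 h'

theorem finite_lists_of_length_le {α : Type*} {s : Set α} (hs : s.Finite) (n : ℕ) :
    {l : List α | l.length ≤ n ∧ ∀ x ∈ l, x ∈ s}.Finite := by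
  have := hs.to_subtype
  refine ((List.finite_length_le s n).image (List.map Subtype.val)).subset ?_
  rintro l ⟨hl, hs⟩
  exact ⟨l.attachWith (· ∈ s) hs, by simpa using hl, by simp⟩

namespace QslnFun

variable {q : ℝ} {N : ℕ} {D : UqslData q N} (P : QslnFun q N D)

/-- `g` is a group-like element of `K`, with right inverse `g'` of the same kind, acting on the
fundamental representation diagonally with eigenvalues `q ^ e i`. -/
structure IsTorusElem (r : ℕ) (g g' : D.U) (e : ℕ → ℤ) : Prop where
  groupLike : IsGroupLikeElem ℂ g
  groupLike' : IsGroupLikeElem ℂ g'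
  mem : g ∈ D.Ksub r
  mem' : g' ∈ D.Ksub r
  mul_eq_one : g * g' = 1
  pair_u : ∀ i ∈ Finset.Icc 1 N, ∀ j ∈ Finset.Icc 1 N,
    P.pair g (P.u i j) = if i = j then (q : ℂ) ^ e i else 0

variable {P} {r : ℕ}

theorem IsTorusElem.one : P.IsTorusElem r 1 1 0 where
  groupLike := .one
  groupLike' := .one
  mem := one_mem _
  mem' := one_mem _
  mul_eq_one := one_mul 1
  pair_u i hi j hj := by simp [P.pair_oneU, P.counit_u i hi j hj]

theorem IsTorusElem.mul (hq : (q : ℂ) ≠ 0) {g g' h h' : D.U} {e f : ℕ → ℤ}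
    (hg : P.IsTorusElem r g g' e) (hh : P.IsTorusElem r h h' f) :
    P.IsTorusElem r (g * h) (h' * g') (e + f) where
  groupLike := hg.groupLike.mul hh.groupLike
  groupLike' := hh.groupLike'.mul hg.groupLike'
  mem := mul_mem hg.mem hh.mem
  mem' := mul_mem hh.mem' hg.mem'
  mul_eq_one := by
    rw [mul_assoc, ← mul_assoc h, hh.mul_eq_one, one_mul, hg.mul_eq_one]
  pair_u i hi j hj := by
    rw [P.pair_mulU, P.comul_u i hi j hj]
    simp only [map_sum, TensorProduct.map_tmul, LinearMap.mul'_apply]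
    rw [Finset.sum_eq_single_of_mem i hi]
    · rw [hg.pair_u i hi i hi, hh.pair_u i hi j hj, if_pos rfl]
      split_ifs <;> simp [zpow_add₀ hq]
    · intro k hk hki
      rw [hg.pair_u i hi k hk, if_neg hki.symm, zero_mul]

theorem IsTorusElem.exists_pow (hq : (q : ℂ) ≠ 0) {g g' : D.U} {e : ℕ → ℤ}
    (hg : P.IsTorusElem r g g' e) (m : ℕ) : ∃ h h', P.IsTorusElem r h h' (m • e) := by
  induction m with
  | zero => exact ⟨1, 1, by simpa using IsTorusElem.one⟩
  | succ m ih =>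
    obtain ⟨h, h', hh⟩ := ih
    exact ⟨h * g, g' * h', succ_nsmul e m ▸ hh.mul hq hg⟩

theorem isTorusElem_Kg {l : ℕ} (hl : l ∈ Finset.Icc 1 (N - 1)) :
    P.IsTorusElem r (D.Kg l) (D.Ki l)
      (fun i => if i = l then 1 else if i = l + 1 then -1 else 0) where
  groupLike := ⟨D.counit_Kg l hl, D.comul_Kg l hl⟩
  groupLike' := ⟨D.counit_Ki l hl, D.comul_Ki l hl⟩
  mem := Algebra.subset_adjoin (Or.inr ⟨l, hl, Or.inl rfl⟩)
  mem' := Algebra.subset_adjoin (Or.inr ⟨l, hl, Or.inr rfl⟩)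
  mul_eq_one := (D.rels.1 l hl).1
  pair_u i hi j hj := by
    rw [P.pair_Kg l hl i hi j hj]
    split_ifs <;> simp

/-- The torus element corresponding to the sum of the positive roots. -/
theorem exists_isTorusElem_two_rho (hq : (q : ℂ) ≠ 0) (hN : 1 ≤ N) :
    ∃ g g' e, P.IsTorusElem r g g' e ∧ ∀ j ∈ Finset.Icc 1 N, e j = N + 1 - 2 * j := by
  have key : ∀ M : ℕ, M ≤ N - 1 → ∃ g g' e, P.IsTorusElem r g g' e ∧
      ∀ j ∈ Finset.Icc 1 N, e j =
        if j ≤ M then (N : ℤ) + 1 - 2 * j else if j = M + 1 then -(M * (N - M)) else 0 := by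
    intro M
    induction M with
    | zero =>
      refine fun _ => ⟨1, 1, 0, .one, fun j hj => ?_⟩
      have := (Finset.mem_Icc.1 hj).1
      rw [if_neg (by omega)]
      simp
    | succ M ih =>
      intro hM
      obtain ⟨g, g', e, hg, he⟩ := ih (by omega)
      obtain ⟨h, h', hh⟩ := (isTorusElem_Kg (P := P) (r := r) (l := M + 1)
        (Finset.mem_Icc.2 ⟨by omega, hM⟩)).exists_pow hq ((M + 1) * (N - (M + 1)))
      refine ⟨_, _, _, hg.mul hq hh, fun j hj => ?_⟩
      have hc : ((N - (M + 1) : ℕ) : ℤ) = N - (M + 1) := by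
        rw [Nat.cast_sub (by omega)]
        simp
      rw [Pi.add_apply, Pi.smul_apply, he j hj, nsmul_eq_mul, Nat.cast_mul, hc]
      rcases lt_trichotomy j (M + 1) with h | rfl | h
      · rw [if_pos (by omega), if_neg (by omega), if_neg (by omega), if_pos (by omega)]
        simp
      · rw [if_neg (by omega), if_pos rfl, if_pos rfl, if_pos le_rfl]
        push_cast
        ring
      · rw [if_neg (by omega), if_neg (by omega), if_neg (by omega),
          if_neg (show ¬j ≤ M + 1 by omega)]
        split_ifs <;> push_cast <;> ring
  obtain ⟨g, g', e, hg, he⟩ := key (N - 1) le_rfl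
  refine ⟨g, g', e, hg, fun j hj => (he j hj).trans ?_⟩
  have := Finset.mem_Icc.1 hj
  have hc : ((N - 1 : ℕ) : ℤ) = N - 1 := by
    rw [Nat.cast_sub hN]
    simp
  split_ifs with h1 h2
  · rfl
  · rw [hc, show j = N by omega]
    ring
  · omega

variable (P) in
/-- The character of `A` given by pairing with a group-like element. -/
def character {g : D.U} (hg : IsGroupLikeElem ℂ g) : P.A →ₐ[ℂ] ℂ :=
  AlgHom.ofLinearMap (P.pair g) (by rw [P.pair_oneA, hg.counit_eq_one]) fun a b => by
    rw [P.pair_mulA, hg.comul_eq_tmul_self]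
    simp

theorem character_toLinearMap {g : D.U} (hg : IsGroupLikeElem ℂ g) :
    (P.character hg).toLinearMap = P.pair g := rfl

theorem hitL_rightHit (k : D.U) (φ : P.A →ₗ[ℂ] ℂ) (a : P.A) :
    P.hitL k (rightHit φ a) = rightHit φ (P.hitL k a) := by
  change TensorProduct.lift ((LinearMap.lsmul ℂ P.A).comp (P.pair k))
    (Coalgebra.comul (R := ℂ) (rightHit φ a)) = rightHit φ (TensorProduct.lift
      ((LinearMap.lsmul ℂ P.A).comp (P.pair k)) (Coalgebra.comul (R := ℂ) a))
  rw [comul_rightHit]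
  generalize Coalgebra.comul (R := ℂ) a = y
  induction y with
  | zero => simp
  | add x y hx hy => simp only [map_add, hx, hy]
  | tmul x y => simp

theorem counit_hitL (k : D.U) (a : P.A) :
    Coalgebra.counit (R := ℂ) (P.hitL k a) = P.pair k a := by
  have h : ∀ y : P.A ⊗[ℂ] P.A, Coalgebra.counit (R := ℂ)
      (TensorProduct.lift ((LinearMap.lsmul ℂ P.A).comp (P.pair k)) y) =
      P.pair k (TensorProduct.rid ℂ P.A ((Coalgebra.counit (R := ℂ)).lTensor P.A y)) := by
    intro y
    induction y with
    | zero => simp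
    | add x y hx hy => simp only [map_add, hx, hy]
    | tmul x y => simp [mul_comm]
  refine (h _).trans ?_
  simp

theorem mem_Bmod_iff {b : P.A} : b ∈ P.Bmod r ↔ ∀ k ∈ D.Ksub r,
    P.hitL (k - algebraMap ℂ D.U (Coalgebra.counit (R := ℂ) k)) b = 0 := by
  simp [Bmod, Submodule.mem_iInf]

theorem rightHit_mem_Bmod (φ : P.A →ₗ[ℂ] ℂ) {b : P.A} (hb : b ∈ P.Bmod r) :
    rightHit φ b ∈ P.Bmod r :=
  mem_Bmod_iff.2 fun k hk => by rw [hitL_rightHit, mem_Bmod_iff.1 hb k hk, map_zero]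

theorem pair_eq_counit_of_mem_Bmod {g : D.U} (hg : IsGroupLikeElem ℂ g) (hgK : g ∈ D.Ksub r)
    {b : P.A} (hb : b ∈ P.Bmod r) : P.pair g b = Coalgebra.counit (R := ℂ) b := by
  have h := congrArg (Coalgebra.counit (R := ℂ)) (mem_Bmod_iff.1 hb g hgK)
  rw [counit_hitL, hg.counit_eq_one, map_one, map_sub, LinearMap.sub_apply, P.pair_oneU,
    map_zero] at h
  exact sub_eq_zero.1 h

theorem pair_eq_zero_of_mem_ABp {Bsub : Subalgebra ℂ P.A}
    (hB : Subalgebra.toSubmodule Bsub = P.Bmod r) {g : D.U} (hg : IsGroupLikeElem ℂ g)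
    (hgK : g ∈ D.Ksub r) : ∀ x ∈ ABp Bsub, P.pair g x = 0 := by
  intro x hx
  have hle : ABp Bsub ≤ LinearMap.ker (P.pair g) := by
    refine Submodule.span_le.2 ?_
    rintro _ ⟨a, b, hb, hb0, rfl⟩
    have hb' : b ∈ P.Bmod r := hB ▸ hb
    have h := map_mul (P.character hg) a b
    have h0 : P.character hg b = 0 :=
      (pair_eq_counit_of_mem_Bmod hg hgK hb').trans hb0
    rw [h0, mul_zero] at h
    exact h
  exact hle hx

/-- The right action of a group-like element of `K` preserves `T^ε`. -/
theorem comp_mem_tangent {Bsub : Subalgebra ℂ P.A}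
    (hB : Subalgebra.toSubmodule Bsub = P.Bmod r) {I : Submodule ℂ ↥Bsub}
    (hI : FODCIdeal Bsub I) {g : D.U} (hg : IsGroupLikeElem ℂ g) (hgK : g ∈ D.Ksub r)
    (R : ↥Bsub →ₗ[ℂ] ↥Bsub) (hR : ∀ b, (R b : P.A) = rightHit (P.pair g) b)
    {f : Module.Dual ℂ ↥Bsub} (hf : f ∈ TanOfIdeal Bsub I ⊔ Submodule.span ℂ {counitB Bsub}) :
    f ∘ₗ R ∈ TanOfIdeal Bsub I ⊔ Submodule.span ℂ {counitB Bsub} := by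
  obtain ⟨f₁, hf₁, f₂, hf₂, rfl⟩ := Submodule.mem_sup.1 hf
  obtain ⟨c, rfl⟩ := Submodule.mem_span_singleton.1 hf₂
  simp only [TanOfIdeal, Submodule.mem_inf, Submodule.mem_iInf, LinearMap.mem_ker,
    Module.Dual.eval_apply, Subtype.forall] at hf₁
  rw [LinearMap.add_comp]
  refine Submodule.add_mem_sup ?_ ?_
  · simp only [TanOfIdeal, Submodule.mem_inf, Submodule.mem_iInf, LinearMap.mem_ker,
      Module.Dual.eval_apply, Subtype.forall]
    constructor
    · intro x hx hxI
      obtain ⟨y, hy, hy'⟩ := rightHit_mem_of_DbarStable hI.2.2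
        (pair_eq_zero_of_mem_ABp hB hg hgK) hxI
      have : R ⟨x, hx⟩ = y := Subtype.ext ((hR _).trans hy'.symm)
      rw [LinearMap.comp_apply, this]
      exact hf₁.1 y y.2 hy
    · have : R 1 = 1 := Subtype.ext <| (hR 1).trans <| by
        rw [← character_toLinearMap hg, ← rightTranslation_apply]
        exact map_one _
      rw [LinearMap.comp_apply, this]
      exact hf₁.2
  · have : (c • counitB Bsub) ∘ₗ R = c • counitB Bsub := by
      ext b
      have hb : (b : P.A) ∈ P.Bmod r := hB ▸ b.2
      have h : Coalgebra.counit (R := ℂ) (R b : P.A) = Coalgebra.counit (R := ℂ) (b : P.A) := by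
        rw [hR, counit_rightHit, pair_eq_counit_of_mem_Bmod hg hgK hb]
      exact congrArg (c * ·) h
    rw [this]
    exact Submodule.smul_mem _ _ (Submodule.mem_span_singleton_self _)

theorem rightHit_u {g g' : D.U} {e : ℕ → ℤ} (hg : P.IsTorusElem r g g' e) {i j : ℕ}
    (hi : i ∈ Finset.Icc 1 N) (hj : j ∈ Finset.Icc 1 N) :
    rightHit (P.pair g) (P.u i j) = (q : ℂ) ^ e j • P.u i j := by
  simp only [rightHit, LinearMap.comp_apply, P.comul_u i hi j hj, map_sum,
    LinearMap.lTensor_tmul, LinearEquiv.coe_coe, TensorProduct.rid_tmul]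
  rw [Finset.sum_eq_single_of_mem j hj]
  · rw [hg.pair_u j hj j hj, if_pos rfl]
  · intro k hk hkj
    rw [hg.pair_u k hk j hj, if_neg hkj, zero_smul]

theorem sum_antipode_u_mul_u {i j : ℕ} (hi : i ∈ Finset.Icc 1 N) (hj : j ∈ Finset.Icc 1 N) :
    ∑ k ∈ Finset.Icc 1 N, HopfAlgebra.antipode (R := ℂ) (P.u i k) * P.u k j =
      if i = j then 1 else 0 := by
  have h := HopfAlgebra.mul_antipode_rTensor_comul_apply (R := ℂ) (P.u i j)
  rw [P.comul_u i hi j hj, P.counit_u i hi j hj] at h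
  simp only [map_sum, LinearMap.rTensor_tmul, LinearMap.mul'_apply] at h
  rw [h]
  split_ifs <;> simp

theorem sum_u_mul_antipode_u {i j : ℕ} (hi : i ∈ Finset.Icc 1 N) (hj : j ∈ Finset.Icc 1 N) :
    ∑ k ∈ Finset.Icc 1 N, P.u i k * HopfAlgebra.antipode (R := ℂ) (P.u k j) =
      if i = j then 1 else 0 := by
  have h := HopfAlgebra.mul_antipode_lTensor_comul_apply (R := ℂ) (P.u i j)
  rw [P.comul_u i hi j hj, P.counit_u i hi j hj] at h
  simp only [map_sum, LinearMap.lTensor_tmul, LinearMap.mul'_apply] at h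
  rw [h]
  split_ifs <;> simp

theorem rightTranslation_antipode_u (hq : (q : ℂ) ≠ 0) {g g' : D.U} {e : ℕ → ℤ}
    (hg : P.IsTorusElem r g g' e) {i j : ℕ}
    (hi : i ∈ Finset.Icc 1 N) (hj : j ∈ Finset.Icc 1 N) :
    rightTranslation (P.character hg.groupLike) (HopfAlgebra.antipode (R := ℂ) (P.u i j)) =
      (q : ℂ) ^ (-e i) • HopfAlgebra.antipode (R := ℂ) (P.u i j) := by
  set R := rightTranslation (P.character hg.groupLike)
  have hRu : ∀ k ∈ Finset.Icc 1 N, ∀ l ∈ Finset.Icc 1 N,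
      R (P.u k l) = (q : ℂ) ^ e l • P.u k l := fun k hk l hl => rightHit_u hg hk hl
  have h1 : ∀ l ∈ Finset.Icc 1 N,
      ∑ k ∈ Finset.Icc 1 N, R (HopfAlgebra.antipode (R := ℂ) (P.u i k)) * P.u k l =
        (q : ℂ) ^ (-e l) • if i = l then 1 else 0 := by
    intro l hl
    have h := congrArg R (sum_antipode_u_mul_u (P := P) hi hl)
    have hR1 : R (if i = l then 1 else 0) = if i = l then 1 else 0 := by
      split_ifs <;> simp
    rw [map_sum, hR1] at h
    rw [← h, Finset.smul_sum]
    refine Finset.sum_congr rfl fun k hk => ?_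
    rw [map_mul, hRu k hk l hl, mul_smul_comm, smul_smul, ← zpow_add₀ hq]
    simp
  calc R (HopfAlgebra.antipode (R := ℂ) (P.u i j))
      = ∑ k ∈ Finset.Icc 1 N, R (HopfAlgebra.antipode (R := ℂ) (P.u i k)) *
          ∑ l ∈ Finset.Icc 1 N, P.u k l * HopfAlgebra.antipode (R := ℂ) (P.u l j) := by
        rw [Finset.sum_eq_single_of_mem j hj]
        · rw [sum_u_mul_antipode_u hj hj, if_pos rfl, mul_one]
        · intro k hk hkj
          rw [sum_u_mul_antipode_u hk hj, if_neg hkj, mul_zero]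
    _ = ∑ l ∈ Finset.Icc 1 N, (∑ k ∈ Finset.Icc 1 N,
          R (HopfAlgebra.antipode (R := ℂ) (P.u i k)) * P.u k l) *
            HopfAlgebra.antipode (R := ℂ) (P.u l j) := by
        simp only [Finset.mul_sum, Finset.sum_mul, mul_assoc]
        exact Finset.sum_comm
    _ = _ := by
        rw [Finset.sum_eq_single_of_mem i hi]
        · rw [h1 i hi, if_pos rfl, smul_mul_assoc, one_mul]
        · intro l hl hli
          rw [h1 l hl, if_neg hli.symm, smul_zero, zero_mul]

theorem rightTranslation_zGen (hq : (q : ℂ) ≠ 0) {g g' : D.U} {e : ℕ → ℤ}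
    (hg : P.IsTorusElem r g g' e) {i j : ℕ}
    (hi : i ∈ Finset.Icc 1 N) (hj : j ∈ Finset.Icc 1 N) :
    rightTranslation (P.character hg.groupLike) (zGen P r i j) =
      (q : ℂ) ^ (e i - e j) • zGen P r i j := by
  simp only [zGen, map_sum, map_smul, map_mul, Finset.smul_sum]
  refine Finset.sum_congr rfl fun k hk => ?_
  have hk' : k ∈ Finset.Icc 1 N :=
    Finset.Icc_subset_Icc_left (by omega) hk
  rw [rightTranslation_antipode_u hq hg hj hk', rightTranslation_apply,
    character_toLinearMap, rightHit_u hg hk' hi, smul_mul_smul_comm, ← zpow_add₀ hq,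
    smul_comm, ← sub_eq_add_neg]

theorem rightTranslation_monomial (hq : (q : ℂ) ≠ 0) {g g' : D.U} {e : ℕ → ℤ}
    (hg : P.IsTorusElem r g g' e) {l : List (ℕ × ℕ)}
    (hl : ∀ p ∈ l, p.1 ∈ Finset.Icc 1 N ∧ p.2 ∈ Finset.Icc 1 N) :
    rightTranslation (P.character hg.groupLike) (l.map fun p => zGen P r p.1 p.2).prod =
      (q : ℂ) ^ (l.map fun p => e p.1 - e p.2).sum • (l.map fun p => zGen P r p.1 p.2).prod := by
  induction l with
  | nil => simp
  | cons p l ih =>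
    obtain ⟨hp, hl⟩ := List.forall_mem_cons.1 hl
    rw [List.map_cons, List.prod_cons, map_mul, ih hl, rightTranslation_zGen hq hg hp.1 hp.2,
      smul_mul_smul_comm, ← zpow_add₀ hq, List.map_cons, List.sum_cons]

/-- The matrix coefficients of `T^ε` vanish on all weight vectors of `B` for the torus element
`g`, apart from finitely many weights. -/
theorem finite_weights_coefficients_ne_zero (hq : Transcendental ℚ q) {g g' : D.U} {e : ℕ → ℤ}
    (hg : P.IsTorusElem r g g' e)
    {Bsub : Subalgebra ℂ P.A} (hB : Subalgebra.toSubmodule Bsub = P.Bmod r)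
    {I : Submodule ℂ ↥Bsub} (hI : FODCIdeal Bsub I)
    {n : ℕ} {t : Fin n → Module.Dual ℂ ↥Bsub} (htind : LinearIndependent ℂ t)
    (htspan : Submodule.span ℂ (Set.range t) =
      TanOfIdeal Bsub I ⊔ Submodule.span ℂ {counitB Bsub})
    {a : Fin n → Fin n → Module.Dual ℂ ↥Bsub}
    (ha : ∀ (i : Fin n) (b c : ↥Bsub), t i (b * c) = ∑ j, a i j b * t j c) :
    {m : ℤ | ∃ b : ↥Bsub, rightTranslation (P.character hg.groupLike) b = (q : ℂ) ^ m • (b : P.A) ∧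
      ∃ i j, a i j b ≠ 0}.Finite := by
  have hmem : ∀ (φ : P.A →ₗ[ℂ] ℂ) (b : ↥Bsub), rightHit φ (b : P.A) ∈ Bsub := fun φ b => by
    have hb : (b : P.A) ∈ P.Bmod r := hB ▸ b.2
    rw [← Subalgebra.mem_toSubmodule, hB]
    exact rightHit_mem_Bmod φ hb
  let R : ↥Bsub →ₐ[ℂ] ↥Bsub :=
    ((rightTranslation (P.character hg.groupLike)).comp Bsub.val).codRestrict Bsub
      fun b => hmem _ b
  let R' : ↥Bsub →ₗ[ℂ] ↥Bsub :=
    (rightHit (P.pair g')).restrict (p := Subalgebra.toSubmodule Bsub)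
      (q := Subalgebra.toSubmodule Bsub) fun b hb => hmem _ ⟨b, hb⟩
  have hRR : ∀ b, R (R' b) = b := fun b => Subtype.ext <| by
    change rightHit (P.pair g) (rightHit (P.pair g') (b : P.A)) = b
    have hconv : P.pair g ∘ₗ rightHit (P.pair g') = Coalgebra.counit (R := ℂ) := by
      ext x
      rw [LinearMap.comp_apply, map_rightHit, ← P.pair_mulU, hg.mul_eq_one, P.pair_oneU]
    rw [rightHit_rightHit, hconv, rightHit_counit]
  have hspan : ∀ i, t i ∈ TanOfIdeal Bsub I ⊔ Submodule.span ℂ {counitB Bsub} := fun i =>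
    htspan ▸ Submodule.subset_span ⟨i, rfl⟩
  have hfin := finite_eigenvalues_coefficients_ne_zero htind ha R R' hRR
    (fun i => htspan ▸ comp_mem_tangent hB hI hg.groupLike hg.mem R.toLinearMap
      (fun _ => rfl) (hspan i))
    (fun i => htspan ▸ comp_mem_tangent hB hI hg.groupLike' hg.mem' R'
      (fun _ => rfl) (hspan i))
  refine (hfin.preimage (zpow_injective_of_transcendental hq).injOn).subset ?_
  rintro m ⟨b, hb, hab⟩
  exact ⟨b, Subtype.ext hb, hab⟩

end QslnFun

/-- For a family of elements indexed by pairs, the monomials with weight in a finite set are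
finite in number as soon as all the weights are positive. -/
theorem finite_monomials_of_finite_weights {A : Type*} [Monoid A] (z : ℕ × ℕ → A)
    {s : Set (ℕ × ℕ)} (hs : s.Finite) {S : Set ℤ} (hS : S.Finite) (w : ℕ × ℕ → ℤ)
    (hw : ∀ p ∈ s, 1 ≤ w p) :
    {x : A | ∃ l : List (ℕ × ℕ), (∀ p ∈ l, p ∈ s) ∧ (l.map w).sum ∈ S ∧
      x = (l.map z).prod}.Finite := by
  obtain ⟨c, hc⟩ := hS.bddAbove
  refine ((finite_lists_of_length_le hs c.toNat).image fun l => (l.map z).prod).subset ?_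
  rintro x ⟨l, hl, hlS, rfl⟩
  refine ⟨l, ⟨?_, hl⟩, rfl⟩
  have hlen : (l.length : ℤ) ≤ (l.map w).sum := by
    have h := List.card_nsmul_le_sum (l.map w) 1 (by
      rintro _ hx
      obtain ⟨p, hp, rfl⟩ := List.mem_map.1 hx
      exact hw p (hl p hp))
    simpa using h
  have := hc hlS
  omega

/-- Corollary `pmnilp`.  The matrix coefficients `a_{ij}` (defined by
`Δ(t_i) = Σ_j a_{ij} ⊗ t_j` for a basis `{t_i}` of `T^ε`) vanish on all but finitely
many elements of `P₊` and of `P₋`, where `P₊` (resp. `P₋`) is the set of monomials in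
the generators `z_{kl}` with `k < l` (resp. `k > l`).  In particular the generators
`z_{kl}` with `k ≠ l` act as nilpotent operators on the finite-dimensional
representation of `B` determined by the `a_{ij}`. -/
theorem matrix_coefficients_vanish_on_cofinitely_many_monomials
    (q : ℝ) (hq : Transcendental ℚ q)
    (N r : ℕ) (hN : 2 ≤ N) (hr1 : 1 ≤ r) (hr2 : r ≤ N - 1)
    (D : UqslData q N) (P : QslnFun q N D)
    (Bsub : Subalgebra ℂ P.A) (hB : Subalgebra.toSubmodule Bsub = P.Bmod r)
    (hzB : ∀ i ∈ Finset.Icc 1 N, ∀ j ∈ Finset.Icc 1 N, zGen P r i j ∈ Bsub)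
    (I : Submodule ℂ ↥Bsub) (hI : FODCIdeal Bsub I)
    (n : ℕ) (t : Fin n → Module.Dual ℂ ↥Bsub)
    (htind : LinearIndependent ℂ t)
    (htspan : Submodule.span ℂ (Set.range t) =
      TanOfIdeal Bsub I ⊔ Submodule.span ℂ {counitB Bsub})
    (a : Fin n → Fin n → Module.Dual ℂ ↥Bsub)
    (ha : ∀ (i : Fin n) (b c : ↥Bsub), t i (b * c) = ∑ j, a i j b * t j c) :
    ({x : ↥Bsub |
        (∃ l : List (ℕ × ℕ),
          (∀ p ∈ l, 1 ≤ p.1 ∧ p.1 < p.2 ∧ p.2 ≤ N) ∧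
          (x : P.A) = (l.map fun p => zGen P r p.1 p.2).prod) ∧
        ∃ i j, a i j x ≠ 0}.Finite) ∧
    ({x : ↥Bsub |
        (∃ l : List (ℕ × ℕ),
          (∀ p ∈ l, 1 ≤ p.2 ∧ p.2 < p.1 ∧ p.1 ≤ N) ∧
          (x : P.A) = (l.map fun p => zGen P r p.1 p.2).prod) ∧
        ∃ i j, a i j x ≠ 0}.Finite) ∧
    (∀ k l : ℕ, ∀ (hk : k ∈ Finset.Icc 1 N) (hl : l ∈ Finset.Icc 1 N), k ≠ l →
      IsNilpotent
        (Matrix.of fun i j : Fin n => a i j ⟨zGen P r k l, hzB k hk l hl⟩)) := by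
  have hq0 : (q : ℂ) ≠ 0 := by
    rw [Complex.ofReal_ne_zero]
    rintro rfl
    exact hq isAlgebraic_zero
  obtain ⟨g, g', e, hg, he⟩ :=
    QslnFun.exists_isTorusElem_two_rho (P := P) (r := r) hq0 (by omega)
  have hS := QslnFun.finite_weights_coefficients_ne_zero hq hg hB hI htind htspan ha
  set S := {m : ℤ | ∃ b : ↥Bsub, rightTranslation (P.character hg.groupLike) b =
    (q : ℂ) ^ m • (b : P.A) ∧ ∃ i j, a i j b ≠ 0}
  have hbox : (Set.Icc 1 N ×ˢ Set.Icc 1 N : Set (ℕ × ℕ)).Finite :=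
    (Set.finite_Icc _ _).prod (Set.finite_Icc _ _)
  refine ⟨?_, ?_, ?_⟩
  · refine Set.Finite.of_finite_image (f := Subtype.val) ?_ Subtype.val_injective.injOn
    refine (finite_monomials_of_finite_weights (fun p => zGen P r p.1 p.2)
      (hbox.subset (Set.sep_subset _ fun p => p.1 < p.2)) hS (fun p => e p.1 - e p.2) ?_).subset ?_
    · rintro p ⟨⟨h1, h2⟩, hp⟩
      rw [he _ (by simpa using h1), he _ (by simpa using h2)]
      omega
    · rintro _ ⟨x, ⟨⟨l, hl, hx⟩, hax⟩, rfl⟩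
      have hl' : ∀ p ∈ l, p.1 ∈ Finset.Icc 1 N ∧ p.2 ∈ Finset.Icc 1 N := fun p hp => by
        have := hl p hp
        simp only [Finset.mem_Icc]
        omega
      refine ⟨l, fun p hp => ⟨⟨by simpa using (hl' p hp).1, by simpa using (hl' p hp).2⟩, (hl p hp).2.1⟩,
        ⟨x, ?_, hax⟩, hx⟩
      rw [hx, QslnFun.rightTranslation_monomial hq0 hg hl']
  · refine Set.Finite.of_finite_image (f := Subtype.val) ?_ Subtype.val_injective.injOn
    refine (finite_monomials_of_finite_weights (fun p => zGen P r p.1 p.2)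
      (hbox.subset (Set.sep_subset _ fun p => p.2 < p.1)) (hS.preimage neg_injective.injOn)
      (fun p => -(e p.1 - e p.2)) ?_).subset ?_
    · rintro p ⟨⟨h1, h2⟩, hp⟩
      rw [he _ (by simpa using h1), he _ (by simpa using h2)]
      omega
    · rintro _ ⟨x, ⟨⟨l, hl, hx⟩, hax⟩, rfl⟩
      have hl' : ∀ p ∈ l, p.1 ∈ Finset.Icc 1 N ∧ p.2 ∈ Finset.Icc 1 N := fun p hp => by
        have := hl p hp
        simp only [Finset.mem_Icc]
        omega
      refine ⟨l, fun p hp => ⟨⟨by simpa using (hl' p hp).1, by simpa using (hl' p hp).2⟩, (hl p hp).2.1⟩,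
        ⟨x, ?_, hax⟩, hx⟩
      have hneg : -(l.map fun p => -(e p.1 - e p.2)).sum = (l.map fun p => e p.1 - e p.2).sum := by
        rw [List.sum_neg, List.map_map]
        simp [Function.comp_def]
      rw [hneg, hx, QslnFun.rightTranslation_monomial hq0 hg hl']
  · intro k l hk hl hkl
    by_contra hnil
    have hmem : ∀ m : ℕ, (m : ℤ) * (e k - e l) ∈ S := by
      intro m
      refine ⟨⟨zGen P r k l, hzB k hk l hl⟩ ^ m, ?_, ?_⟩
      · rw [SubmonoidClass.coe_pow, map_pow, QslnFun.rightTranslation_zGen hq0 hg hk hl, smul_pow,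
          ← zpow_natCast, ← zpow_mul, mul_comm]
      · by_contra! h0
        refine hnil ⟨m, ?_⟩
        rw [← coefficient_matrix_pow htind ha]
        ext i j
        exact h0 i j
    have hne : e k - e l ≠ 0 := by
      rw [he k hk, he l hl]
      omega
    exact Set.infinite_of_injective_forall_mem
      (fun m m' h => by simpa [hne] using h) hmem hS
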